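/- For pairwise distinct α₁,...,α_m, the graceful basis element g_i can be written as g_i(x) = ∑_{n≥0} p_{i,n}(α) x^n/n! where each p_{i,n} is a polynomial in α₁,...,α_m with integer coefficients; consequently each g_i extends to an entire function of (x, α₁,...,α_m) ∈ ℂ^{m+1}. -/

import Mathlib

open Finset

/-- The graceful basis element (indexed by `i : Fin m`, playing the role of `i+1`). -/
noncomputable def gracefulBasis (m : ℕ) (α : Fin m → ℂ) (i : Fin m) : ℂ → ℂ := fun x =>
  ∑ j : Fin m,
    (-1 : ℂ) ^ (m - 1 - (i : ℕ)) *
      (∑ s ∈ ((Finset.univ : Finset (Fin m)).erase j).powersetCard (m - 1 - (i : ℕ)),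
        ∏ k ∈ s, α k) /
      (∏ k ∈ (Finset.univ : Finset (Fin m)).erase j, (α j - α k)) *
      Complex.exp (α j * x)

section Companion

open Polynomial

/-- The companion matrix of `∏ k, (X - α k)` for generic roots: its `l`-th column consists of the
coefficients of the remainder of `X ^ (l + 1)`. -/
noncomputable def genericCompanion (m : ℕ) : Matrix (Fin m) (Fin m) (MvPolynomial (Fin m) ℤ) :=
  Matrix.of fun k l =>
    ((X ^ ((l : ℕ) + 1) : (MvPolynomial (Fin m) ℤ)[X]) %ₘ
      ∏ a : Fin m, (X - C (MvPolynomial.X a))).coeff k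

/-- The companion matrix of `∏ k, (X - α k)`. -/
noncomputable def companionAt {m : ℕ} (α : Fin m → ℂ) : Matrix (Fin m) (Fin m) ℂ :=
  (genericCompanion m).map (MvPolynomial.aeval α)

theorem companionAt_apply {m : ℕ} (α : Fin m → ℂ) (k l : Fin m) :
    companionAt α k l =
      ((X ^ ((l : ℕ) + 1) : ℂ[X]) %ₘ ∏ a : Fin m, (X - C (α a))).coeff k := by
  have hmonic : (∏ a : Fin m, (X - C (MvPolynomial.X a : MvPolynomial (Fin m) ℤ))).Monic :=
    monic_prod_X_sub_C _ _
  have h := map_modByMonic (p := X ^ ((l : ℕ) + 1))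
    (MvPolynomial.aeval α : MvPolynomial (Fin m) ℤ →ₐ[ℤ] ℂ).toRingHom hmonic
  simp only [Polynomial.map_pow, Polynomial.map_prod, Polynomial.map_sub, map_X, map_C] at h
  simp only [AlgHom.toRingHom_eq_coe, RingHom.coe_coe, MvPolynomial.aeval_X] at h
  rw [← h, coeff_map]
  rfl

theorem companionAt_pow_apply {m : ℕ} (α : Fin m → ℂ) (n : ℕ) (k l : Fin m) :
    (companionAt α ^ n) k l = MvPolynomial.aeval α ((genericCompanion m ^ n) k l) := by
  have h := map_pow (MvPolynomial.aeval α : MvPolynomial (Fin m) ℤ →ₐ[ℤ] ℂ).mapMatrix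
    (genericCompanion m) n
  exact (congrFun (congrFun h k) l).symm

theorem sum_pow_mul_companionAt {m : ℕ} (α : Fin m → ℂ) (j l : Fin m) :
    ∑ k : Fin m, α j ^ (k : ℕ) * companionAt α k l = α j * α j ^ (l : ℕ) := by
  set q : ℂ[X] := ∏ a : Fin m, (X - C (α a)) with hq
  have hmonic : q.Monic := monic_prod_X_sub_C _ _
  have hdeg : q.natDegree = m := by simp [hq]
  have hroot : q.eval (α j) = 0 := by
    rw [hq, eval_prod]
    exact prod_eq_zero (mem_univ j) (by simp)
  have hne : q ≠ 1 := fun h => by simp [h] at hroot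
  have hnat : (X ^ ((l : ℕ) + 1) %ₘ q).natDegree < m :=
    (natDegree_modByMonic_lt _ hmonic hne).trans_eq hdeg
  have heval : (X ^ ((l : ℕ) + 1) %ₘ q).eval (α j) = α j ^ ((l : ℕ) + 1) := by
    simp [modByMonic_eq_sub_mul_div, hroot]
  rw [eval_eq_sum_range' hnat, sum_range] at heval
  simp only [companionAt_apply, ← hq]
  rw [← pow_succ', ← heval]
  exact sum_congr rfl fun k _ => mul_comm _ _

theorem sum_pow_mul_companionAt_pow {m : ℕ} (α : Fin m → ℂ) (n : ℕ) (j l : Fin m) :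
    ∑ k : Fin m, α j ^ (k : ℕ) * (companionAt α ^ n) k l = α j ^ n * α j ^ (l : ℕ) := by
  induction n generalizing l with
  | zero => simp [Matrix.one_apply]
  | succ n ih =>
    simp only [pow_succ (companionAt α), Matrix.mul_apply, mul_sum]
    rw [sum_comm]
    simp only [← mul_assoc, ← sum_mul, ih]
    simp only [mul_assoc, ← mul_sum, sum_pow_mul_companionAt]
    ring

theorem coeff_prod_X_sub_C {R ι : Type*} [CommRing R] (s : Finset ι) (f : ι → R) {i : ℕ}
    (hi : i ≤ #s) :
    (∏ k ∈ s, (X - C (f k))).coeff i =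
      (-1) ^ (#s - i) * ∑ t ∈ s.powersetCard (#s - i), ∏ k ∈ t, f k := by
  have h := Finset.prod_X_add_C_coeff s (fun k => -f k) hi
  simp only [map_neg, ← sub_eq_add_neg] at h
  rw [h, mul_sum]
  refine sum_congr rfl fun t ht => ?_
  rw [prod_neg, (mem_powersetCard.1 ht).2]

theorem coeff_lagrangeBasis {m : ℕ} (α : Fin m → ℂ) (i j : Fin m) :
    (Lagrange.basis univ α j).coeff i =
      (-1 : ℂ) ^ (m - 1 - (i : ℕ)) *
        (∑ s ∈ ((univ : Finset (Fin m)).erase j).powersetCard (m - 1 - (i : ℕ)), ∏ k ∈ s, α k) /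
        (∏ k ∈ (univ : Finset (Fin m)).erase j, (α j - α k)) := by
  have hcard : #((univ : Finset (Fin m)).erase j) = m - 1 := by simp
  have h := coeff_prod_X_sub_C (univ.erase j) α (i := i) (by omega)
  rw [hcard] at h
  simp only [Lagrange.basis, Lagrange.basisDivisor, prod_mul_distrib, ← map_prod, coeff_C_mul, h,
    prod_inv_distrib]
  ring

theorem companionAt_pow_eq_sum {m : ℕ} {α : Fin m → ℂ} (hα : Function.Injective α) (n : ℕ)
    (i : Fin m) :
    (companionAt α ^ n) i ⟨0, i.pos⟩ =
      ∑ j : Fin m, (Lagrange.basis univ α j).coeff i * α j ^ n := by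
  set q : ℂ[X] := ∑ k : Fin m, C ((companionAt α ^ n) k ⟨0, i.pos⟩) * X ^ (k : ℕ) with hq
  have hdeg : q.degree < #(univ : Finset (Fin m)) := by
    rw [card_fin]
    exact degree_sum_fin_lt fun k => (companionAt α ^ n) k ⟨0, i.pos⟩
  have heval (j : Fin m) : q.eval (α j) = α j ^ n := by
    have h := sum_pow_mul_companionAt_pow α n j ⟨0, i.pos⟩
    rw [pow_zero, mul_one] at h
    rw [hq, eval_finsetSum, ← h]
    refine sum_congr rfl fun k _ => ?_
    rw [eval_mul, eval_C, eval_pow, eval_X, mul_comm]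
  have h := congrArg (fun r => r.coeff (i : ℕ))
    (Lagrange.eq_interpolate_of_eval_eq (fun j => α j ^ n) hα.injOn hdeg fun j _ => heval j)
  simp only [hq, Lagrange.interpolate_apply, finsetSum_coeff, coeff_C_mul, coeff_X_pow,
    Fin.val_inj, mul_ite, mul_one, mul_zero, sum_ite_eq, mem_univ, if_true] at h
  rw [h]
  exact sum_congr rfl fun j _ => mul_comm _ _

end Companion

theorem hasSum_gracefulBasis {m : ℕ} {α : Fin m → ℂ} (hα : Function.Injective α) (i : Fin m)
    (x : ℂ) :
    HasSum (fun n : ℕ => (companionAt α ^ n) i ⟨0, i.pos⟩ * x ^ n / (Nat.factorial n))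
      (gracefulBasis m α i x) := by
  simp only [gracefulBasis, ← coeff_lagrangeBasis, companionAt_pow_eq_sum hα]
  have hexp (j : Fin m) :
      HasSum (fun n : ℕ => (α j * x) ^ n / (Nat.factorial n : ℂ)) (Complex.exp (α j * x)) := by
    rw [Complex.exp_eq_exp_ℂ]
    exact NormedSpace.expSeries_div_hasSum_exp (α j * x)
  refine (hasSum_sum fun j _ => (hexp j).mul_left
    ((Lagrange.basis univ α j).coeff (i : ℕ))).congr_fun fun n => ?_
  rw [sum_mul, sum_div]
  exact sum_congr rfl fun j _ => by ring

section MatrixExponential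

attribute [local instance] Matrix.linftyOpNormedRing Matrix.linftyOpNormedAlgebra

theorem Matrix.hasSum_exp_smul_apply {m : ℕ} (A : Matrix (Fin m) (Fin m) ℂ) (x : ℂ)
    (k l : Fin m) :
    HasSum (fun n : ℕ => (A ^ n) k l * x ^ n / (Nat.factorial n))
      (NormedSpace.exp (x • A) k l) := by
  have h := (NormedSpace.exp_series_hasSum_exp' (𝕂 := ℂ) (x • A)).map
    (Matrix.entryLinearMap ℂ ℂ k l)
    (LinearMap.continuous_of_finiteDimensional (Matrix.entryLinearMap ℂ ℂ k l))
  refine h.congr_fun fun n => ?_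
  simp [smul_pow]
  ring

theorem analyticAt_companionAt {m : ℕ} (α : Fin m → ℂ) :
    AnalyticAt ℂ (fun β : Fin m → ℂ => companionAt β) α := by
  have h : (fun β : Fin m → ℂ => companionAt β) = fun β =>
      ∑ k, ∑ l, companionAt β k l • Matrix.single k l (1 : ℂ) := by
    funext β
    conv_lhs => rw [Matrix.matrix_eq_sum_single (companionAt β)]
    simp [Matrix.smul_single]
  rw [h]
  refine Finset.analyticAt_fun_sum _ fun k _ => Finset.analyticAt_fun_sum _ fun l _ => ?_
  have hentry : AnalyticAt ℂ (fun β : Fin m → ℂ => companionAt β k l) α :=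
    AnalyticAt.aeval_mvPolynomial (fun a => (ContinuousLinearMap.proj (R := ℂ) (φ := fun _ : Fin m => ℂ) a).analyticAt α)
      (genericCompanion m k l)
  exact hentry.smul analyticAt_const

theorem analyticAt_exp_smul_companionAt {m : ℕ} (k l : Fin m) (z : ℂ × (Fin m → ℂ)) :
    AnalyticAt ℂ (fun y : ℂ × (Fin m → ℂ) => NormedSpace.exp (y.1 • companionAt y.2) k l) z := by
  have hlin : AnalyticAt ℂ (fun y : ℂ × (Fin m → ℂ) => y.1 • companionAt y.2) z :=
    analyticAt_fst.smul ((analyticAt_companionAt z.2).comp analyticAt_snd)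
  have hexp := (NormedSpace.exp_analytic (𝕂 := ℂ) (z.1 • companionAt z.2)).comp_of_eq hlin rfl
  exact ((Matrix.entryLinearMap ℂ ℂ k l).toContinuousLinearMap.analyticAt _).comp_of_eq hexp rfl

end MatrixExponential

/-- Each graceful basis element is `∑_{n≥0} p_{i,n}(α) x^n/n!` with `p_{i,n}` integer
polynomials in `α`; consequently it extends to an entire function of `(x, α) ∈ ℂ^{m+1}`. -/
theorem gracefulBasis_polynomial_coefficients (m : ℕ) :
    ∃ p : Fin m → ℕ → MvPolynomial (Fin m) ℤ,
      (∀ α : Fin m → ℂ, Function.Injective α → ∀ i : Fin m, ∀ x : ℂ,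
        HasSum (fun n : ℕ =>
            MvPolynomial.aeval α (p i n) * x ^ n / (Nat.factorial n))
          (gracefulBasis m α i x)) ∧
      ∃ G : Fin m → ℂ × (Fin m → ℂ) → ℂ,
        (∀ i, AnalyticOn ℂ (G i) Set.univ) ∧
        ∀ i : Fin m, ∀ x : ℂ, ∀ α : Fin m → ℂ, Function.Injective α →
          G i (x, α) = gracefulBasis m α i x := by
  refine ⟨fun i n => (genericCompanion m ^ n) i ⟨0, i.pos⟩, fun α hα i x => ?_,
    fun i z => NormedSpace.exp (z.1 • companionAt z.2) i ⟨0, i.pos⟩,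
    fun i z _ => (analyticAt_exp_smul_companionAt i ⟨0, i.pos⟩ z).analyticWithinAt,
    fun i x α hα => ?_⟩
  · simpa only [companionAt_pow_apply] using hasSum_gracefulBasis hα i x
  · exact (Matrix.hasSum_exp_smul_apply (companionAt α) x i ⟨0, i.pos⟩).unique
      (hasSum_gracefulBasis hα i x)
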